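/- Let n ≥ m ≥ 3 and F = (x_1^2 + ... + x_m^2)(y_1^2 + ... + y_n^2). Then the Waring rank of F satisfies rk F > n(m+2). -/

import Mathlib

open MvPolynomial
open scoped Classical

/-- The Waring rank of a degree-`d` form `F`: the least `r` such that `F` is a
linear combination of `r` `d`-th powers of linear forms. -/
noncomputable def waringRank {σ : Type*} [Fintype σ] (d : ℕ) (F : MvPolynomial σ ℂ) : ℕ :=
  sInf {r | ∃ c : Fin r → ℂ, ∃ L : Fin r → σ → ℂ,
    F = ∑ i, MvPolynomial.C (c i) * (∑ j, MvPolynomial.C (L i j) * X j) ^ d}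

section Moments

variable {K A ι J : Type*} [Field K] [CommRing A] [Algebra K A]

/-- The products `x i * Y j`, the elements `Y j` and the products `x p ^ 2 * Y j`. -/
def momentFamily (x : ι → A) (Y : J → A) (p : ι) : (ι × J) ⊕ (J ⊕ J) → A :=
  Sum.elim (fun s => x s.1 * Y s.2) (Sum.elim Y fun j => x p * x p * Y j)

theorem map_momentFamily_sum_mul [Fintype ι] [Fintype J] (φ : A →ₗ[K] K) (x : ι → A)
    (Y : J → A) (p : ι)
    (c : (ι × J) ⊕ (J ⊕ J) → K) (g : A) :
    φ ((∑ s, c s • momentFamily x Y p s) * g) =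
      ∑ s : ι × J, c (Sum.inl s) * φ (x s.1 * Y s.2 * g) +
        (∑ j, c (Sum.inr (Sum.inl j)) * φ (Y j * g) +
          ∑ j, c (Sum.inr (Sum.inr j)) * φ (x p * x p * Y j * g)) := by
  simp only [Fintype.sum_sum_type, momentFamily, Sum.elim_inl, Sum.elim_inr, add_mul,
    Finset.sum_mul, map_add, map_sum, smul_mul_assoc, map_smul, smul_eq_mul]

/-- The fourth order moments, with respect to `φ`, of a sum of fourth powers representing a
multiple of `(∑ x i ^ 2) * (∑ Y j ^ 2)`, dehomogenized at `Y o`. -/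
structure HasQuadricProductMoments (φ : A →ₗ[K] K) (x : ι → A) (Y : J → A) (o : J) (κ : K) :
    Prop where
  one : Y o = 1
  ne_zero : κ ≠ 0
  moment_xxYY : ∀ a b j k, φ (x a * x b * Y j * Y k) = if a = b ∧ j = k then κ else 0
  moment_xxxY : ∀ a b c j, φ (x a * x b * x c * Y j) = 0
  moment_xYYY : ∀ a j k l, φ (x a * Y j * Y k * Y l) = 0
  moment_YYYY : ∀ i j k l, φ (Y i * Y j * Y k * Y l) = 0

namespace HasQuadricProductMoments

variable {φ : A →ₗ[K] K} {x : ι → A} {Y : J → A} {o : J} {κ : K}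

theorem moment_xYY (h : HasQuadricProductMoments φ x Y o κ) (a j k) :
    φ (x a * Y j * Y k) = 0 := by
  simpa [h.one] using h.moment_xYYY a j k o

theorem moment_YYY (h : HasQuadricProductMoments φ x Y o κ) (i j k) :
    φ (Y i * Y j * Y k) = 0 := by
  simpa [h.one] using h.moment_YYYY i j k o

theorem moment_YY (h : HasQuadricProductMoments φ x Y o κ) (i j) :
    φ (Y i * Y j) = 0 := by
  simpa [h.one] using h.moment_YYY i j o

variable [Fintype ι] [Fintype J]

theorem coeff_eq_zero (h : HasQuadricProductMoments φ x Y o κ) (p : ι)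
    (c : (ι × J) ⊕ (J ⊕ J) → K)
    (h₁ : ∀ l, φ ((∑ s, c s • momentFamily x Y p s) * Y l) = 0)
    (h₂ : ∀ a l, φ ((∑ s, c s • momentFamily x Y p s) * (x a * Y l)) = 0) :
    (∀ s, c (Sum.inl s) = 0) ∧ ∀ j, c (Sum.inr (Sum.inr j)) = 0 := by
  have hζ : ∀ j, c (Sum.inr (Sum.inr j)) = 0 := by
    intro l
    have := h₁ l
    rw [map_momentFamily_sum_mul] at this
    simpa [h.moment_xYY, h.moment_YY, h.moment_xxYY, h.ne_zero] using this
  refine ⟨?_, hζ⟩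
  rintro ⟨a, l⟩
  have := h₂ a l
  rw [map_momentFamily_sum_mul] at this
  have e₁ : ∀ i j, φ (x i * Y j * (x a * Y l)) = if (i, j) = (a, l) then κ else 0 := by
    intro i j
    rw [show x i * Y j * (x a * Y l) = x i * x a * Y j * Y l by ring, h.moment_xxYY]
    simp only [Prod.mk.injEq]
  have e₂ : ∀ j, φ (Y j * (x a * Y l)) = 0 := by
    intro j
    rw [show Y j * (x a * Y l) = x a * Y j * Y l by ring, h.moment_xYY]
  simpa [e₁, e₂, hζ, h.ne_zero] using this

theorem linearIndependent (h : HasQuadricProductMoments φ x Y o κ) (p : ι) :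
    LinearIndependent K (momentFamily x Y p) := by
  rw [Fintype.linearIndependent_iff]
  intro c hc
  obtain ⟨hδ, hζ⟩ := h.coeff_eq_zero p c (by simp [hc]) (by simp [hc])
  rintro (s | l | j)
  · exact hδ s
  · have := map_momentFamily_sum_mul φ x Y p c (x p * x p * Y l)
    have e : ∀ j, φ (Y j * (x p * x p * Y l)) = if j = l then κ else 0 := by
      intro j
      rw [show Y j * (x p * x p * Y l) = x p * x p * Y j * Y l by ring, h.moment_xxYY]
      simp
    simpa [hc, hδ, hζ, e, h.ne_zero] using this
  · exact hζ j

theorem mem_span (h : HasQuadricProductMoments φ x Y o κ) {p : ι}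
    (hspan : ⊤ ≤ Submodule.span K (Set.range (momentFamily x Y p))) (f : A)
    (h₁ : ∀ l, φ (f * Y l) = 0) (h₂ : ∀ a l, φ (f * (x a * Y l)) = 0) :
    f ∈ Submodule.span K (Set.range Y) := by
  obtain ⟨c, rfl⟩ := (Submodule.mem_span_range_iff_exists_fun K).1
    (hspan (Submodule.mem_top (x := f)))
  obtain ⟨hδ, hζ⟩ := h.coeff_eq_zero p c h₁ h₂
  refine (Submodule.mem_span_range_iff_exists_fun K).2 ⟨fun j => c (Sum.inr (Sum.inl j)), ?_⟩
  simp [Fintype.sum_sum_type, momentFamily, hδ, hζ]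

theorem eq_zero_of_mul_mem_span (h : HasQuadricProductMoments φ x Y o κ) (p : ι) {f : A}
    (hf : f ∈ Submodule.span K (Set.range Y))
    (hxf : x p * x p * f ∈ Submodule.span K (Set.range Y)) : f = 0 := by
  obtain ⟨γ, rfl⟩ := (Submodule.mem_span_range_iff_exists_fun K).1 hf
  obtain ⟨δ, hδ⟩ := (Submodule.mem_span_range_iff_exists_fun K).1 hxf
  have := Fintype.linearIndependent_iff.1 (h.linearIndependent p)
    (Sum.elim 0 (Sum.elim (-δ) γ)) (by
      simp [Fintype.sum_sum_type, momentFamily, hδ, Finset.mul_sum])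
  refine Finset.sum_eq_zero fun j _ => ?_
  have hj := this (Sum.inr (Sum.inr j))
  simp only [Sum.elim_inr] at hj
  rw [hj, zero_smul]

theorem not_top_le_span [IsReduced A] (h : HasQuadricProductMoments φ x Y o κ) {p q s : ι}
    (hpq : p ≠ q) (hps : p ≠ s) (hqs : q ≠ s) :
    ¬ ⊤ ≤ Submodule.span K (Set.range (momentFamily x Y p)) := by
  intro hspan
  set V := Submodule.span K (Set.range Y) with hV
  have hYY : ∀ j k, Y j * Y k ∈ V := by
    intro j k
    refine h.mem_span hspan _ (fun l => h.moment_YYY j k l) fun a l => ?_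
    rw [show Y j * Y k * (x a * Y l) = x a * Y j * Y k * Y l by ring, h.moment_xYYY]
  have hmul : ∀ {f g : A}, f ∈ V → g ∈ V → f * g ∈ V := by
    intro f g hf hg
    have hle : V * V ≤ V := by
      rw [hV, Submodule.span_mul_span, Submodule.span_le]
      rintro _ ⟨_, ⟨j, rfl⟩, _, ⟨k, rfl⟩, rfl⟩
      exact hYY j k
    exact hle (Submodule.mul_mem_mul hf hg)
  have hxx : ∀ a b l, φ (x a * x b * Y l) = if a = b ∧ l = o then κ else 0 := by
    intro a b l
    simpa [h.one] using h.moment_xxYY a b l o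
  have hxxx : ∀ a b c l, φ (x a * x b * (x c * Y l)) = 0 := by
    intro a b c l
    rw [← mul_assoc, h.moment_xxxY]
  have hne : ∀ {a b}, a ≠ b → x a * x b ∈ V := by
    intro a b hab
    exact h.mem_span hspan _ (fun l => by simp [hxx, hab]) fun c l => hxxx a b c l
  have hsub : ∀ a b, x a * x a - x b * x b ∈ V := by
    intro a b
    exact h.mem_span hspan _ (fun l => by simp [sub_mul, hxx])
      fun c l => by simp [sub_mul, hxxx]
  have hpq0 : x p * x q = 0 := by
    refine h.eq_zero_of_mul_mem_span p (hne hpq) ?_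
    have := V.add_mem (hmul (hsub p s) (hne hpq)) (hmul (hne hps) (hne hqs))
    convert this using 1
    ring
  have hsq : x p * x p - x q * x q = 0 := by
    refine h.eq_zero_of_mul_mem_span p (hsub p q) ?_
    have h₁ := V.add_mem (hmul (hsub p q) (hsub p s)) (hmul (hne hps) (hne hps))
    have h₂ := V.sub_mem h₁ (hmul (hne hqs) (hne hqs))
    convert h₂ using 1
    ring
  have hp : x p ^ 4 = 0 := by
    linear_combination x p ^ 2 * hsq + x p * x q * hpq0
  have hp0 : x p = 0 := eq_zero_of_pow_eq_zero hp
  have := hxx p p o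
  simp [hp0, h.ne_zero.symm] at this

theorem lt_finrank [IsReduced A] [Module.Finite K A]
    (h : HasQuadricProductMoments φ x Y o κ) {p q s : ι}
    (hpq : p ≠ q) (hps : p ≠ s) (hqs : q ≠ s) :
    Fintype.card J * (Fintype.card ι + 2) < Module.finrank K A := by
  have hcard : Fintype.card ((ι × J) ⊕ (J ⊕ J)) = Fintype.card J * (Fintype.card ι + 2) := by
    simp only [Fintype.card_sum, Fintype.card_prod]
    ring
  have hli := h.linearIndependent p
  rw [← hcard]
  refine lt_of_le_of_ne hli.fintype_card_le_finrank fun heq => ?_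
  exact h.not_top_le_span hpq hps hqs (hli.span_eq_top_of_card_eq_finrank' heq).ge

end HasQuadricProductMoments

end Moments

/-- A vector whose Householder reflection moves the coordinate form at `o` to a form that
vanishes at no nonzero member of a finite family. -/
theorem exists_householder_vector {ι J : Type*} [Fintype ι] [Fintype J] {o k : J} (hok : k ≠ o)
    (b : ι → J → ℂ) :
    ∃ v : J → ℂ, v ⬝ᵥ v ≠ 0 ∧ ∀ i, b i ≠ 0 → b i o * (v ⬝ᵥ v) - 2 * v o * (v ⬝ᵥ b i) ≠ 0 := by
  let Q : MvPolynomial J ℂ := ∑ j, X j * X j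
  let P : ι → MvPolynomial J ℂ := fun i => C (b i o) * Q - 2 * X o * ∑ j, X j * C (b i j)
  have hQ : ∀ v, eval v Q = v ⬝ᵥ v := fun v => by simp [Q, dotProduct]
  have hP : ∀ i v, eval v (P i) = b i o * (v ⬝ᵥ v) - 2 * v o * (v ⬝ᵥ b i) := fun i v => by
    simp [P, hQ, dotProduct]
  have hQ0 : Q ≠ 0 := by
    intro h
    have := hQ (Pi.single k 1)
    simp [h] at this
  have hP0 : ∀ i, b i ≠ 0 → P i ≠ 0 := by
    intro i hi h
    have hval : ∀ v : J → ℂ, b i o * (v ⬝ᵥ v) - 2 * v o * (v ⬝ᵥ b i) = 0 := fun v => by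
      rw [← hP, h, map_zero]
    have ho : b i o = 0 := by
      simpa [hok.symm] using hval (Pi.single k 1)
    refine hi (funext fun l => ?_)
    by_cases hl : l = o
    · simpa [hl] using ho
    · let u : J → ℂ := Pi.single o 1 + Pi.single l 1
      have huo : u o = 1 := by simp [u, Ne.symm hl]
      have hub : u ⬝ᵥ b i = b i l := by
        simp only [u, add_dotProduct, single_one_dotProduct, ho, zero_add]
      simpa [ho, huo, hub] using hval u
  have hne : Q * ∏ i with b i ≠ 0, P i ≠ 0 :=
    mul_ne_zero hQ0 (Finset.prod_ne_zero_iff.2 fun i hi => hP0 i (Finset.mem_filter.1 hi).2)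
  obtain ⟨v, hv⟩ : ∃ v, eval v (Q * ∏ i with b i ≠ 0, P i) ≠ 0 := by
    by_contra! hcon
    exact hne (MvPolynomial.funext fun v => by rw [hcon v, map_zero])
  rw [map_mul, map_prod, mul_ne_zero_iff, Finset.prod_ne_zero_iff, hQ] at hv
  refine ⟨v, hv.1, fun i hi => ?_⟩
  rw [← hP]
  exact hv.2 i (by simp [hi])

/-- An orthonormal system, indexed by the coordinates, whose member at `o` pairs nontrivially
with every nonzero member of a finite family. -/
theorem exists_orthonormal_dotProduct_ne_zero {ι J : Type*} [Fintype ι] [Fintype J] {o k : J}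
    (hok : k ≠ o) (b : ι → J → ℂ) :
    ∃ e : J → J → ℂ, (∀ j l, e j ⬝ᵥ e l = if j = l then 1 else 0) ∧
      ∀ i, b i ≠ 0 → b i ⬝ᵥ e o ≠ 0 := by
  obtain ⟨v, hv, hb⟩ := exists_householder_vector hok b
  refine ⟨fun j => Pi.single j 1 - (2 * v j / (v ⬝ᵥ v)) • v, fun j l => ?_, fun i hi h => ?_⟩
  · have h1 : (Pi.single j 1 : J → ℂ) ⬝ᵥ Pi.single l 1 = if j = l then 1 else 0 := by
      simp [Pi.single_apply, eq_comm]
    simp only [sub_dotProduct, dotProduct_sub, smul_dotProduct, dotProduct_smul, h1,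
      single_one_dotProduct, dotProduct_single_one v, smul_eq_mul]
    field_simp
    ring
  · refine hb i hi ?_
    simp only [dotProduct_sub, dotProduct_smul, dotProduct_single_one, smul_eq_mul,
      dotProduct_comm (b i) v] at h
    field_simp at h
    linear_combination h

section Polarization

variable {ι I J : Type*} [Fintype ι] [Fintype I] [Fintype J]

theorem sum_mul_polarization {c : ι → ℂ} {a : ι → I → ℂ} {b : ι → J → ℂ}
    (h : ∀ x y, ∑ i, c i * (a i ⬝ᵥ x + b i ⬝ᵥ y) ^ 4 = (x ⬝ᵥ x) * (y ⬝ᵥ y))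
    (x₁ x₂ x₃ x₄ : I → ℂ) (y₁ y₂ y₃ y₄ : J → ℂ) :
    6 * ∑ i, c i * ((a i ⬝ᵥ x₁ + b i ⬝ᵥ y₁) * (a i ⬝ᵥ x₂ + b i ⬝ᵥ y₂) *
      (a i ⬝ᵥ x₃ + b i ⬝ᵥ y₃) * (a i ⬝ᵥ x₄ + b i ⬝ᵥ y₄)) =
      (x₁ ⬝ᵥ x₂) * (y₃ ⬝ᵥ y₄) + (x₁ ⬝ᵥ x₃) * (y₂ ⬝ᵥ y₄) + (x₁ ⬝ᵥ x₄) * (y₂ ⬝ᵥ y₃) +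
      (x₂ ⬝ᵥ x₃) * (y₁ ⬝ᵥ y₄) + (x₂ ⬝ᵥ x₄) * (y₁ ⬝ᵥ y₃) + (x₃ ⬝ᵥ x₄) * (y₁ ⬝ᵥ y₂) := by
  have hpol : ∀ i, 24 * (c i * ((a i ⬝ᵥ x₁ + b i ⬝ᵥ y₁) * (a i ⬝ᵥ x₂ + b i ⬝ᵥ y₂) *
      (a i ⬝ᵥ x₃ + b i ⬝ᵥ y₃) * (a i ⬝ᵥ x₄ + b i ⬝ᵥ y₄))) =
      c i * (a i ⬝ᵥ (x₁ + x₂ + x₃ + x₄) + b i ⬝ᵥ (y₁ + y₂ + y₃ + y₄)) ^ 4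
      - c i * (a i ⬝ᵥ (x₁ + x₂ + x₃) + b i ⬝ᵥ (y₁ + y₂ + y₃)) ^ 4
      - c i * (a i ⬝ᵥ (x₁ + x₂ + x₄) + b i ⬝ᵥ (y₁ + y₂ + y₄)) ^ 4
      - c i * (a i ⬝ᵥ (x₁ + x₃ + x₄) + b i ⬝ᵥ (y₁ + y₃ + y₄)) ^ 4
      - c i * (a i ⬝ᵥ (x₂ + x₃ + x₄) + b i ⬝ᵥ (y₂ + y₃ + y₄)) ^ 4
      + c i * (a i ⬝ᵥ (x₁ + x₂) + b i ⬝ᵥ (y₁ + y₂)) ^ 4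
      + c i * (a i ⬝ᵥ (x₁ + x₃) + b i ⬝ᵥ (y₁ + y₃)) ^ 4
      + c i * (a i ⬝ᵥ (x₁ + x₄) + b i ⬝ᵥ (y₁ + y₄)) ^ 4
      + c i * (a i ⬝ᵥ (x₂ + x₃) + b i ⬝ᵥ (y₂ + y₃)) ^ 4
      + c i * (a i ⬝ᵥ (x₂ + x₄) + b i ⬝ᵥ (y₂ + y₄)) ^ 4
      + c i * (a i ⬝ᵥ (x₃ + x₄) + b i ⬝ᵥ (y₃ + y₄)) ^ 4
      - c i * (a i ⬝ᵥ x₁ + b i ⬝ᵥ y₁) ^ 4 - c i * (a i ⬝ᵥ x₂ + b i ⬝ᵥ y₂) ^ 4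
      - c i * (a i ⬝ᵥ x₃ + b i ⬝ᵥ y₃) ^ 4 - c i * (a i ⬝ᵥ x₄ + b i ⬝ᵥ y₄) ^ 4 := by
    intro i
    simp only [dotProduct_add]
    ring
  have hsum := Finset.sum_congr rfl fun i (_ : i ∈ Finset.univ) => hpol i
  rw [← Finset.mul_sum] at hsum
  simp only [Finset.sum_add_distrib, Finset.sum_sub_distrib, h] at hsum
  simp only [dotProduct_add, add_dotProduct, dotProduct_comm x₂ x₁, dotProduct_comm x₃ x₁,
    dotProduct_comm x₄ x₁, dotProduct_comm x₃ x₂, dotProduct_comm x₄ x₂, dotProduct_comm x₄ x₃,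
    dotProduct_comm y₂ y₁, dotProduct_comm y₃ y₁, dotProduct_comm y₄ y₁, dotProduct_comm y₃ y₂,
    dotProduct_comm y₄ y₂, dotProduct_comm y₄ y₃] at hsum
  linear_combination (1 / 4) * hsum

theorem card_lt_of_sum_pow_four_eq {c : ι → ℂ} {a : ι → I → ℂ} {b : ι → J → ℂ}
    (h : ∀ x y, ∑ i, c i * (a i ⬝ᵥ x + b i ⬝ᵥ y) ^ 4 = (x ⬝ᵥ x) * (y ⬝ᵥ y))
    {p q s : I} (hpq : p ≠ q) (hps : p ≠ s) (hqs : q ≠ s) {o k : J} (hok : k ≠ o) :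
    Fintype.card J * (Fintype.card I + 2) < Fintype.card ι := by
  obtain ⟨e, he, hb⟩ := exists_orthonormal_dotProduct_ne_zero hok b
  let S := {i : ι // b i ⬝ᵥ e o ≠ 0}
  let x : I → S → ℂ := fun u i => a i u / (b i ⬝ᵥ e o)
  let Y : J → S → ℂ := fun j i => (b i ⬝ᵥ e j) / (b i ⬝ᵥ e o)
  let φ : (S → ℂ) →ₗ[ℂ] ℂ :=
    ∑ i : S, (c i * (b i ⬝ᵥ e o) ^ 4) • (LinearMap.proj i : (S → ℂ) →ₗ[ℂ] ℂ)
  have hφ : ∀ (f : S → ℂ) (g : ι → ℂ) (j : J),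
      (∀ i : S, (b i ⬝ᵥ e o) ^ 4 * f i = g i * (b i ⬝ᵥ e j)) →
      φ f = ∑ i, c i * (g i * (b i ⬝ᵥ e j)) := by
    intro f g j hfg
    have hzero : ∀ i ∈ Finset.univ, c i * (g i * (b i ⬝ᵥ e j)) ≠ 0 → b i ⬝ᵥ e o ≠ 0 := by
      intro i _ hi
      refine hb i fun hbi => hi ?_
      simp [hbi]
    rw [← Finset.sum_filter_of_ne hzero, Finset.sum_subtype (p := fun i => b i ⬝ᵥ e o ≠ 0)
      (Finset.univ.filter fun i => b i ⬝ᵥ e o ≠ 0) (by simp)]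
    simp only [φ, LinearMap.sum_apply, LinearMap.smul_apply, LinearMap.proj_apply, smul_eq_mul]
    refine Finset.sum_congr rfl fun i _ => ?_
    rw [mul_assoc, hfg i]
  have hpol := sum_mul_polarization h
  have hmom : HasQuadricProductMoments φ x Y o (1 / 6) := by
    constructor
    · funext i
      exact div_self i.2
    · norm_num
    · intro u v j l
      rw [hφ _ (fun i => a i u * a i v * (b i ⬝ᵥ e j)) l]
      · have := hpol (Pi.single u 1) (Pi.single v 1) 0 0 0 0 (e j) (e l)
        simp only [dotProduct_single_one, dotProduct_zero, zero_dotProduct, he, add_zero,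
          zero_add, mul_zero, Pi.single_apply, eq_comm (a := v)] at this
        by_cases h1 : u = v <;> by_cases h2 : j = l <;>
          simp only [h1, h2, if_true, if_false, and_self, and_true, and_false,
            mul_zero, mul_one] at this ⊢ <;>
          linear_combination (1 / 6) * this
      · intro i
        have := i.2
        simp only [x, Y, Pi.mul_apply]
        field_simp
    · intro u v w j
      rw [hφ _ (fun i => a i u * a i v * a i w) j]
      · have := hpol (Pi.single u 1) (Pi.single v 1) (Pi.single w 1) 0 0 0 0 (e j)
        simp only [dotProduct_single_one, dotProduct_zero, zero_dotProduct, add_zero,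
          zero_add, mul_zero] at this
        linear_combination (1 / 6) * this
      · intro i
        have := i.2
        simp only [x, Y, Pi.mul_apply]
        field_simp
    · intro u j l w
      rw [hφ _ (fun i => a i u * (b i ⬝ᵥ e j) * (b i ⬝ᵥ e l)) w]
      · have := hpol (Pi.single u 1) 0 0 0 0 (e j) (e l) (e w)
        simp only [dotProduct_single_one, dotProduct_zero, zero_dotProduct, add_zero,
          zero_add, zero_mul] at this
        linear_combination (1 / 6) * this
      · intro i
        have := i.2
        simp only [x, Y, Pi.mul_apply]
        field_simp
    · intro u j l w
      rw [hφ _ (fun i => (b i ⬝ᵥ e u) * (b i ⬝ᵥ e j) * (b i ⬝ᵥ e l)) w]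
      · have := hpol 0 0 0 0 (e u) (e j) (e l) (e w)
        simp only [dotProduct_zero, add_zero, zero_add, zero_mul] at this
        linear_combination (1 / 6) * this
      · intro i
        have := i.2
        simp only [Y, Pi.mul_apply]
        field_simp
  calc Fintype.card J * (Fintype.card I + 2) < Module.finrank ℂ (S → ℂ) :=
        hmom.lt_finrank hpq hps hqs
    _ = Fintype.card S := Module.finrank_fintype_fun_eq_card ℂ
    _ ≤ Fintype.card ι := Fintype.card_subtype_le _

end Polarization

theorem exists_waring_decomposition (I J : Type*) [Fintype I] [Fintype J] :
    ∃ r, ∃ c : Fin r → ℂ, ∃ L : Fin r → I ⊕ J → ℂ,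
      (∑ i, (X (Sum.inl i) : MvPolynomial (I ⊕ J) ℂ) ^ 2) * ∑ j, (X (Sum.inr j)) ^ 2 =
        ∑ i, C (c i) * (∑ j, C (L i j) * X j) ^ 4 := by
  let c : (I × J) × Fin 4 → ℂ := fun s => ![1 / 12, 1 / 12, -1 / 6, -1 / 6] s.2
  let L : (I × J) × Fin 4 → I ⊕ J → ℂ := fun s =>
    Sum.elim (Pi.single s.1.1 (![1, 1, 1, 0] s.2)) (Pi.single s.1.2 (![1, -1, 0, 1] s.2))
  have hL : ∀ s, ∑ j, C (L s j) * X j =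
      (C (![1, 1, 1, 0] s.2) * X (Sum.inl s.1.1) +
        C (![1, -1, 0, 1] s.2) * X (Sum.inr s.1.2) : MvPolynomial (I ⊕ J) ℂ) := by
    intro s
    simp only [L, Fintype.sum_sum_type, Sum.elim_inl, Sum.elim_inr, Pi.single_apply,
      apply_ite (C : ℂ → MvPolynomial (I ⊕ J) ℂ), map_zero, ite_mul, zero_mul,
      Finset.sum_ite_eq', Finset.mem_univ, if_true]
  let E := (Fintype.equivFin ((I × J) × Fin 4)).symm
  refine ⟨_, c ∘ E, L ∘ E, ?_⟩
  simp only [Function.comp_apply]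
  rw [E.sum_comp (fun s => C (c s) * (∑ j, C (L s j) * X j) ^ 4), Fintype.sum_prod_type,
    Fintype.sum_prod_type, Finset.sum_mul_sum]
  refine Finset.sum_congr rfl fun i _ => Finset.sum_congr rfl fun j _ => ?_
  simp only [hL, c, Fin.sum_univ_four]
  have h6 : (C (-1 / 6) : MvPolynomial (I ⊕ J) ℂ) = -2 * C (1 / 12) := by
    rw [show (-2 : MvPolynomial (I ⊕ J) ℂ) = C (-2) by rw [C_neg, map_ofNat], ← C_mul]
    norm_num
  have h12 : 12 * (C (1 / 12) : MvPolynomial (I ⊕ J) ℂ) = 1 := by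
    rw [show (12 : MvPolynomial (I ⊕ J) ℂ) = C 12 by rw [map_ofNat], ← C_mul, ← C_1]
    norm_num
  simp [-one_div, h6]
  linear_combination (-(X (Sum.inl i) : MvPolynomial (I ⊕ J) ℂ) ^ 2 * X (Sum.inr j) ^ 2) * h12

/-- For `n ≥ m ≥ 3` and `F = (x_1^2 + ⋯ + x_m^2)(y_1^2 + ⋯ + y_n^2)`, `rk F > n(m+2)`. -/
theorem statement15 (m n : ℕ) (hm : 3 ≤ m) (hmn : m ≤ n) :
    n * (m + 2) < waringRank 4
      ((∑ i, (X (Sum.inl i) : MvPolynomial (Fin m ⊕ Fin n) ℂ) ^ 2) *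
        ∑ j, (X (Sum.inr j)) ^ 2) := by
  obtain ⟨c, L, hF⟩ := Nat.sInf_mem (exists_waring_decomposition (Fin m) (Fin n))
  have heval : ∀ (x : Fin m → ℂ) (y : Fin n → ℂ),
      ∑ i, c i * ((fun u => L i (Sum.inl u)) ⬝ᵥ x + (fun j => L i (Sum.inr j)) ⬝ᵥ y) ^ 4 =
        (x ⬝ᵥ x) * (y ⬝ᵥ y) := by
    intro x y
    have := congrArg (eval (Sum.elim x y)) hF
    simp only [map_mul, map_sum, map_pow, map_add, eval_X, eval_C, Sum.elim_inl, Sum.elim_inr,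
      Fintype.sum_sum_type] at this
    simp only [dotProduct, ← pow_two]
    exact this.symm
  have := card_lt_of_sum_pow_four_eq heval
    (p := ⟨0, by omega⟩) (q := ⟨1, by omega⟩) (s := ⟨2, by omega⟩) (by simp) (by simp) (by simp)
    (o := ⟨0, by omega⟩) (k := ⟨1, by omega⟩) (by simp)
  simp only [Fintype.card_fin] at this
  exact this
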